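/- Let F and B be metric spaces with F locally compact and locally connected and such that the controlled deformation principle L′(F) holds, and let p : F × B → B be the projection. Fix b ∈ B and identify F with p⁻¹(b). Let U be an open subset of F with compact closure, C a compact subset of U, N a neighborhood of b, and f : U × N → F × B a Lipschitz product chart about U for p that is locally L-bi-Lipschitz. Then there exist constants C₀, M ≥ 1 independent of f and L, a neighborhood N′ of b, and a Lipschitz product chart g : F × N′ → F × B about F for p that is locally C₀·L^M-bi-Lipschitz, with g = f on a neighborhood of C × {b} and g = identity outside K × N′ for some compact neighborhood K of C. -/

import Mathlib

open Topology Metric Set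

universe u v

section Defs

variable {X Y : Type*}

/-- A (local) Lipschitz embedding: `f` is injective, locally Lipschitz, and its inverse
`f ⁻¹ : f(X) → X` is locally Lipschitz. -/
def IsLipschitzEmbedding [MetricSpace X] [MetricSpace Y] (f : X → Y) : Prop :=
  Function.Injective f ∧ LocallyLipschitz f ∧
    ∃ g : Set.range f → X, Function.LeftInverse g (Set.rangeFactorization f) ∧ LocallyLipschitz g

/-- An open Lipschitz embedding: a Lipschitz embedding with open image. -/
def IsOpenLipschitzEmbedding [MetricSpace X] [MetricSpace Y] (f : X → Y) : Prop :=
  IsLipschitzEmbedding f ∧ IsOpen (Set.range f)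

/-- A Lipschitz isomorphism: a surjective Lipschitz embedding. -/
def IsLipschitzIso [MetricSpace X] [MetricSpace Y] (f : X → Y) : Prop :=
  IsLipschitzEmbedding f ∧ Function.Surjective f

/-- The inclusion of a subset, as a continuous map. -/
def inclCM [TopologicalSpace X] (U : Set X) : C(↥U, X) :=
  ⟨Subtype.val, continuous_subtype_val⟩

/-- The data of a deformation rule `h ↦ D h` for the principle `L(X; C; U)`:
the rule is continuous near the inclusion, sends the inclusion to the identity, and sends any
open Lipschitz embedding `h` in the neighbourhood `N` of the inclusion to a Lipschitz
isomorphism of `X` agreeing with `h` on `C` and with the inclusion outside `U`. -/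
def DeformationData [MetricSpace X] (U C : Set X) (N : Set C(↥U, X))
    (D : C(↥U, X) → C(X, X)) : Prop :=
  ContinuousOn D {h | h ∈ N ∧ IsOpenLipschitzEmbedding (⇑h : ↥U → X)} ∧
  D (inclCM U) = ContinuousMap.id X ∧
  ∀ h ∈ N, IsOpenLipschitzEmbedding (⇑h : ↥U → X) →
    IsLipschitzIso (⇑(D h) : X → X) ∧
    (∀ x : ↥U, (x : X) ∈ C → D h x = h x) ∧
    (∀ x : X, x ∉ U → D h x = x)

/-- Sullivan's Lipschitz deformation principle `L(X)`. -/
def LipschitzDeformationPrinciple (X : Type v) [MetricSpace X] : Prop :=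
  ∀ U : Set X, IsOpen U → ∀ C : Set X, IsCompact C → C ⊆ U →
    ∃ N ∈ 𝓝 (inclCM U), ∃ D : C(↥U, X) → C(X, X), DeformationData U C N D

end Defs

section BiLip

variable {X Y : Type*}

/-- `f` is (globally) `L`-bi-Lipschitz: `dist x y / L ≤ dist (f x) (f y) ≤ L * dist x y`. -/
def IsBiLipschitzWith [MetricSpace X] [MetricSpace Y] (L : ℝ) (f : X → Y) : Prop :=
  ∀ x y : X, dist x y / L ≤ dist (f x) (f y) ∧ dist (f x) (f y) ≤ L * dist x y

/-- `f` is locally `L`-bi-Lipschitz: every point has a neighbourhood on which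
`dist x y / L ≤ dist (f x) (f y) ≤ L * dist x y`. -/
def IsLocallyBiLipschitzWith [MetricSpace X] [MetricSpace Y] (L : ℝ) (f : X → Y) : Prop :=
  ∀ x : X, ∃ O ∈ 𝓝 x, ∀ a ∈ O, ∀ b ∈ O,
    dist a b / L ≤ dist (f a) (f b) ∧ dist (f a) (f b) ≤ L * dist a b

end BiLip

section Controlled

/-- A Lipschitz isotopy: an open embedding between products of metric spaces which respects
the projection onto the first factor and is a Lipschitz isomorphism onto its image
(i.e. a Lipschitz embedding). -/
def IsLipschitzIsotopy {B X Y : Type*} [MetricSpace B] [MetricSpace X] [MetricSpace Y]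
    (F : B × X → B × Y) : Prop :=
  IsOpenEmbedding F ∧ (∀ q, (F q).1 = q.1) ∧ IsLipschitzEmbedding F

/-- The controlled principle `L′(X)`: `L(X)` together with constants `C, K ≥ 1`, depending
only on `X`, such that the deformation rule sends (locally) `L`-bi-Lipschitz Lipschitz
isotopies to (locally) `C L ^ K`-bi-Lipschitz Lipschitz isotopies. -/
def ControlledDeformationPrinciple (X : Type v) [MetricSpace X] : Prop :=
  ∃ Cc K : ℝ, 1 ≤ Cc ∧ 1 ≤ K ∧
    ∀ U : Set X, IsOpen U → ∀ C : Set X, IsCompact C → C ⊆ U →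
      ∃ N ∈ 𝓝 (inclCM U), ∃ D : C(↥U, X) → C(X, X), DeformationData U C N D ∧
        ∀ (Z : Type u) [MetricSpace Z] (h : Z → C(↥U, X)),
          (∀ t, h t ∈ N ∧ IsOpenLipschitzEmbedding (⇑(h t) : ↥U → X)) →
          IsLipschitzIsotopy (fun q : Z × ↥U => (q.1, h q.1 q.2)) →
          ∀ L : ℝ, 1 ≤ L →
            (IsLocallyBiLipschitzWith L (fun q : Z × ↥U => (q.1, h q.1 q.2)) →
              IsLipschitzIsotopy (fun q : Z × X => (q.1, D (h q.1) q.2)) ∧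
              IsLocallyBiLipschitzWith (Cc * L ^ K)
                (fun q : Z × X => (q.1, D (h q.1) q.2))) ∧
            (IsBiLipschitzWith L (fun q : Z × ↥U => (q.1, h q.1 q.2)) →
              IsLipschitzIsotopy (fun q : Z × X => (q.1, D (h q.1) q.2)) ∧
              IsBiLipschitzWith (Cc * L ^ K)
                (fun q : Z × X => (q.1, D (h q.1) q.2)))

end Controlled

section ProjChart

/-- A Lipschitz product chart about `U` for the projection `p : F × B → B`, under the
identification of `F` with the fiber `p ⁻¹ b = F × {b}`. -/
def IsProjProductChart {F B : Type*} [MetricSpace F] [MetricSpace B]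
    (b : B) (U : Set F) (N : Set B) (f : ↥U × ↥N → F × B) : Prop :=
  b ∈ N ∧ IsOpenLipschitzEmbedding f ∧
    (∀ z : ↥U × ↥N, (f z).2 = (z.2 : B)) ∧
    (∀ (u : ↥U) (hb : b ∈ N), f (u, ⟨b, hb⟩) = ((u : F), b))

end ProjChart

/-! helpers -/

theorem IsLipschitzEmbedding.transfer {X Y X' Y' : Type*} [MetricSpace X] [MetricSpace Y]
    [MetricSpace X'] [MetricSpace Y'] {f : X → Y} (hf : IsLipschitzEmbedding f)
    {e : X' → X} (he : Isometry e) {φ : X' → Y'}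
    (h : ∀ a c, dist (φ a) (φ c) = dist (f (e a)) (f (e c))) : IsLipschitzEmbedding φ := by
  obtain ⟨hi, hl, g, hg, hgl⟩ := hf
  have hφi : Function.Injective φ := by
    intro a c hac
    have h1 := h a c
    rw [hac, dist_self] at h1
    exact he.injective (hi (dist_eq_zero.1 h1.symm))
  refine ⟨hφi, ?_, ?_⟩
  · intro x
    obtain ⟨K, t, ht, hK⟩ := hl (e x)
    refine ⟨K, e ⁻¹' t, he.continuous.continuousAt ht, LipschitzOnWith.of_dist_le_mul ?_⟩
    intro a ha c hc
    rw [h, ← he.dist_eq a c]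
    exact hK.dist_le_mul _ ha _ hc
  · let γ : Set.range φ → X' := fun y => y.2.choose
    have hγ : ∀ y, φ (γ y) = y := fun y => y.2.choose_spec
    let j : Set.range φ → Set.range f := fun y => Set.rangeFactorization f (e (γ y))
    have hj : Isometry j := by
      refine Isometry.of_dist_eq fun a c => ?_
      change dist (f (e (γ a))) (f (e (γ c))) = _
      rw [← h, hγ, hγ, Subtype.dist_eq]
    have hgj : ∀ y, g (j y) = e (γ y) := fun y => hg _
    refine ⟨γ, fun x => hφi (hγ _), ?_⟩
    intro y
    obtain ⟨K, t, ht, hK⟩ := hgl (j y)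
    refine ⟨K, j ⁻¹' t, hj.continuous.continuousAt ht, LipschitzOnWith.of_dist_le_mul ?_⟩
    intro a ha c hc
    rw [← he.dist_eq, ← hgj, ← hgj, ← hj.dist_eq a c]
    exact hK.dist_le_mul _ ha _ hc

theorem IsLocallyBiLipschitzWith.transfer {X Y X' Y' : Type*} [MetricSpace X] [MetricSpace Y]
    [MetricSpace X'] [MetricSpace Y'] {L : ℝ} {f : X → Y} (hf : IsLocallyBiLipschitzWith L f)
    {e : X' → X} (he : Isometry e) {φ : X' → Y'}
    (h : ∀ a c, dist (φ a) (φ c) = dist (f (e a)) (f (e c))) :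
    IsLocallyBiLipschitzWith L φ := by
  intro x
  obtain ⟨O, hO, hh⟩ := hf (e x)
  refine ⟨e ⁻¹' O, he.continuous.continuousAt hO, fun a ha c hc => ?_⟩
  rw [h, ← he.dist_eq a c]
  exact hh _ ha _ hc

theorem IsLipschitzEmbedding.isEmb {X Y : Type*} [MetricSpace X] [MetricSpace Y]
    {f : X → Y} (hf : IsLipschitzEmbedding f) : IsEmbedding f := by
  obtain ⟨hi, hl, g, hg, hgl⟩ := hf
  have h1 : IsEmbedding (Set.rangeFactorization f) :=
    IsEmbedding.of_leftInverse hg hgl.continuous (hl.continuous.subtype_mk _)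
  exact IsEmbedding.subtypeVal.comp h1

/-- Corollary 6.5: extension of product charts for a projection, with Lipschitz constant
control.  Let `F` be locally compact and locally connected with `L′(F)` and let
`p : F × B → B` be the projection.  Let `U ⊆ F` be open with compact closure and `C ⊆ U`
compact.  Then there are constants `C₀, M ≥ 1`, independent of the chart and of `L`, such
that every locally `L`-bi-Lipschitz Lipschitz product chart `f : U × N → F × B` about `U`
for `p` extends to a locally `C₀ L ^ M`-bi-Lipschitz Lipschitz product chart
`g : F × N' → F × B` about `F` for `p`, with `g = f` near `C × {b}` and `g = id` outside
`K × N'` for some compact neighbourhood `K` of `C`. -/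
theorem controlled_proj_product_chart_extension
    {F B : Type u} [MetricSpace F] [MetricSpace B]
    [LocallyCompactSpace F] [LocallyConnectedSpace F]
    (hL : ControlledDeformationPrinciple.{u} F)
    (b : B) (U : Set F) (hU : IsOpen U) (hUc : IsCompact (closure U))
    (C : Set F) (hC : IsCompact C) (hCU : C ⊆ U) :
    ∃ C₀ M : ℝ, 1 ≤ C₀ ∧ 1 ≤ M ∧
      ∀ N : Set B, N ∈ 𝓝 b → ∀ f : ↥U × ↥N → F × B, ∀ L : ℝ, 1 ≤ L →
        IsProjProductChart b U N f → IsLocallyBiLipschitzWith L f →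
        ∃ N' ∈ 𝓝 b, ∃ g : F × ↥N' → F × B,
          (IsOpenLipschitzEmbedding g ∧
            (∀ z : F × ↥N', (g z).2 = (z.2 : B)) ∧
            (∀ (u : F) (hb : b ∈ N'), g (u, ⟨b, hb⟩) = (u, b))) ∧
          IsLocallyBiLipschitzWith (C₀ * L ^ M) g ∧
          (∃ W : Set F, IsOpen W ∧ C ⊆ W ∧ ∃ (hWU : W ⊆ U),
            ∃ Mb ∈ 𝓝 b, ∃ (hMN : Mb ⊆ N) (hMN' : Mb ⊆ N'),
              ∀ x (hx : x ∈ W), ∀ t (ht : t ∈ Mb),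
                g (x, ⟨t, hMN' ht⟩) = f (⟨x, hWU hx⟩, ⟨t, hMN ht⟩)) ∧
          (∃ Kc : Set F, IsCompact Kc ∧ C ⊆ interior Kc ∧
            ∀ x ∉ Kc, ∀ t : ↥N', g (x, t) = (x, (t : B))) := by
  obtain ⟨Cc, K, hCc, hK, H⟩ := hL
  refine ⟨Cc, K, hCc, hK, ?_⟩
  intro N hN f L hL1 hf hfL
  obtain ⟨hbN, ⟨hfe, hfo⟩, hf2, hfb⟩ := hf
  obtain ⟨C1, hC1, hCC1, hC1U⟩ := exists_compact_between hC hU hCU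
  obtain ⟨𝒩, h𝒩, D, ⟨-, hDid, hD⟩, HD⟩ := H U hU C1 hC1 hC1U
  have hfc : Continuous f := hfe.2.1.continuous
  -- the family over `N`
  let Φ : C(↥N, C(↥U, F)) :=
    ContinuousMap.curry ⟨fun q : ↥N × ↥U => (f (q.2, q.1)).1, by fun_prop⟩
  have hΦ : ∀ t x, Φ t x = (f (x, t)).1 := fun t x => rfl
  have hfΦ : ∀ x t, f (x, t) = (Φ t x, (t : B)) := fun x t => Prod.ext rfl (hf2 (x, t))
  have hΦb : Φ ⟨b, hbN⟩ = inclCM U := by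
    ext x
    rw [hΦ, hfb x hbN]; rfl
  have hpre : Φ ⁻¹' 𝒩 ∈ 𝓝 (⟨b, hbN⟩ : ↥N) := by
    apply Φ.continuous.continuousAt
    rw [hΦb]; exact h𝒩
  obtain ⟨A, hA, hAN⟩ := mem_nhds_subtype N _ _ |>.1 hpre
  obtain ⟨N', hN's, hN'o, hbN'⟩ := _root_.mem_nhds_iff.1 (Filter.inter_mem hN hA)
  have hN'N : N' ⊆ N := fun t ht => (hN's ht).1
  have hN'A : ∀ t (ht : t ∈ N'), Φ ⟨t, hN'N ht⟩ ∈ 𝒩 := fun t ht =>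
    hAN (show (⟨t, hN'N ht⟩ : ↥N) ∈ Subtype.val ⁻¹' A from (hN's ht).2)
  let h : ↥N' → C(↥U, F) := fun t => Φ ⟨t, hN'N t.2⟩
  have hfh : ∀ x (t : ↥N'), f (x, ⟨t, hN'N t.2⟩) = (h t x, (t : B)) := fun x t => hfΦ x _
  have hrange : ∀ y (t : ↥N'), (y, (t : B)) ∈ Set.range f ↔ ∃ x, h t x = y := by
    intro y t
    constructor
    · rintro ⟨⟨x, s⟩, hxs⟩
      have hs : s = ⟨t, hN'N t.2⟩ := by
        apply Subtype.ext
        have := hf2 (x, s)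
        rw [hxs] at this
        exact this.symm
      subst hs
      rw [hfh] at hxs
      exact ⟨x, congrArg Prod.fst hxs⟩
    · rintro ⟨x, rfl⟩
      exact ⟨_, hfh x t⟩
  have hhe : ∀ t, IsOpenLipschitzEmbedding (⇑(h t) : ↥U → F) := by
    intro t
    constructor
    · refine hfe.transfer (e := fun x => (x, ⟨t, hN'N t.2⟩))
        (Isometry.of_dist_eq fun a c => by simp [Prod.dist_eq]) fun a c => ?_
      rw [hfh, hfh]; simp [Prod.dist_eq]
    · have : Set.range (h t) = (fun y => (y, (t : B))) ⁻¹' Set.range f := by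
        ext y; exact (hrange y t).symm
      rw [this]
      exact hfo.preimage (by fun_prop)
  have heI : Isometry (fun q : ↥N' × ↥U => ((q.2, ⟨q.1, hN'N q.1.2⟩) : ↥U × ↥N)) :=
    Isometry.of_dist_eq fun a c => by
      simp only [Prod.dist_eq, Subtype.dist_eq]; exact max_comm _ _
  have heD : ∀ a c : ↥N' × ↥U, dist ((a.1, h a.1 a.2) : ↥N' × F) (c.1, h c.1 c.2) =
      dist (f (a.2, ⟨a.1, hN'N a.1.2⟩)) (f (c.2, ⟨c.1, hN'N c.1.2⟩)) := by
    intro a c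
    rw [hfh, hfh]; simp only [Prod.dist_eq, Subtype.dist_eq]; exact max_comm _ _
  have hiso : IsLipschitzIsotopy (fun q : ↥N' × ↥U => (q.1, h q.1 q.2)) := by
    have hE : IsLipschitzEmbedding (fun q : ↥N' × ↥U => (q.1, h q.1 q.2)) :=
      hfe.transfer heI heD
    refine ⟨⟨hE.isEmb, ?_⟩, fun q => rfl, hE⟩
    have : Set.range (fun q : ↥N' × ↥U => (q.1, h q.1 q.2)) =
        (fun q : ↥N' × F => (q.2, (q.1 : B))) ⁻¹' Set.range f := by
      ext ⟨t, y⟩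
      rw [Set.mem_preimage, hrange]
      constructor
      · rintro ⟨⟨s, x⟩, hx⟩
        obtain ⟨rfl, h2⟩ := Prod.mk.inj hx
        exact ⟨x, h2⟩
      · rintro ⟨x, hx⟩
        exact ⟨(t, x), Prod.ext rfl hx⟩
    rw [this]
    exact hfo.preimage (by fun_prop)
  have hhN : ∀ t, h t ∈ 𝒩 := fun t => hN'A t t.2
  obtain ⟨⟨hΨo, -, hΨe⟩, hΨL⟩ :=
    (HD ↥N' h (fun t => ⟨hhN t, hhe t⟩) hiso L hL1).1 (hfL.transfer heI heD)
  let g : F × ↥N' → F × B := fun z => (D (h z.2) z.1, (z.2 : B))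
  have hsI : Isometry (Prod.swap : F × ↥N' → ↥N' × F) :=
    Isometry.of_dist_eq fun a c => by simp only [Prod.dist_eq]; exact max_comm _ _
  have hsD : ∀ a c : F × ↥N', dist (g a) (g c) =
      dist ((fun q : ↥N' × F => (q.1, D (h q.1) q.2)) a.swap)
        ((fun q : ↥N' × F => (q.1, D (h q.1) q.2)) c.swap) := by
    intro a c
    simp only [g, Prod.dist_eq, Subtype.dist_eq]; exact max_comm _ _
  have hN'nhds : N' ∈ 𝓝 b := hN'o.mem_nhds hbN'
  refine ⟨N', hN'nhds, g, ⟨⟨hΨe.transfer hsI hsD, ?_⟩, fun z => rfl, ?_⟩,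
    hΨL.transfer hsI hsD, ?_, ?_⟩
  · have hJ : IsOpenMap (fun q : ↥N' × F => ((q.2, (q.1 : B)) : F × B)) :=
      (IsOpenMap.id.prodMap hN'o.isOpenMap_subtype_val).comp
        (Homeomorph.prodComm ↥N' F).isOpenMap
    have : Set.range g = (fun q : ↥N' × F => ((q.2, (q.1 : B)) : F × B)) ''
        Set.range (fun q : ↥N' × F => (q.1, D (h q.1) q.2)) := by
      ext y
      constructor
      · rintro ⟨z, rfl⟩
        exact ⟨_, ⟨z.swap, rfl⟩, rfl⟩
      · rintro ⟨_, ⟨q, rfl⟩, rfl⟩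
        exact ⟨q.swap, rfl⟩
    rw [this]
    exact hJ _ hΨo.isOpen_range
  · intro u hb
    have : h ⟨b, hb⟩ = inclCM U := hΦb
    simp only [g, this, hDid]; rfl
  · refine ⟨interior C1, isOpen_interior, hCC1, interior_subset.trans hC1U, N', hN'nhds,
      hN'N, subset_rfl, fun x hx t ht => ?_⟩
    have h1 := (hD _ (hhN ⟨t, ht⟩) (hhe _)).2.1 ⟨x, hC1U (interior_subset hx)⟩
      (interior_subset hx)
    refine Eq.trans ?_ (hfh ⟨x, hC1U (interior_subset hx)⟩ ⟨t, ht⟩).symm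
    exact Prod.ext h1 rfl
  · refine ⟨closure U, hUc, hCU.trans (hU.subset_interior_iff.2 subset_closure), ?_⟩
    intro x hx t
    exact Prod.ext ((hD _ (hhN t) (hhe _)).2.2 x fun hxU => hx (subset_closure hxU)) rfl
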